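/- arXiv:1403.6135 — 5 statements merged into one kernel-verified Lean document; each statement's English description precedes it below -/
import Mathlib

section
/- Let Q be a nonempty finite set, ε > 0, Δ > 0, and let u, u' : Q → ℝ satisfy |u(q) − u'(q)| ≤ Δ for every q ∈ Q. Define probability mass functions p(q) = exp(ε·u(q)/(2Δ)) / Σ_{q'∈Q} exp(ε·u(q')/(2Δ)) and p'(q) = exp(ε·u'(q)/(2Δ)) / Σ_{q'∈Q} exp(ε·u'(q')/(2Δ)). Then p(q) ≤ e^ε · p'(q) for every q ∈ Q. -/
open Real

theorem exp_score_le_exp_half_mul {ε Δ a b : ℝ} (hε : 0 < ε) (hΔ : 0 < Δ) (h : a - b ≤ Δ) :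
    exp (ε * a / (2 * Δ)) ≤ exp (ε / 2) * exp (ε * b / (2 * Δ)) := by
  rw [← exp_add, exp_le_exp, show ε / 2 = ε * Δ / (2 * Δ) by field_simp, ← add_div, ← mul_add]
  gcongr
  linarith

/-- The exponential mechanism over a finite range is ε-differentially private:
if the two scoring functions differ pointwise by at most `Δ`, the output probability
mass functions satisfy `p q ≤ e^ε p' q` pointwise. -/
theorem exponential_mechanism_dp {Q : Type*} [Fintype Q] [Nonempty Q]
    (ε Δ : ℝ) (hε : 0 < ε) (hΔ : 0 < Δ)
    (u u' : Q → ℝ) (h : ∀ q, |u q - u' q| ≤ Δ) (q : Q) :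
    exp (ε * u q / (2 * Δ)) / (∑ r : Q, exp (ε * u r / (2 * Δ))) ≤
      exp ε * (exp (ε * u' q / (2 * Δ)) / (∑ r : Q, exp (ε * u' r / (2 * Δ)))) := by
  have hpos : ∀ v : Q → ℝ, 0 < ∑ r : Q, exp (ε * v r / (2 * Δ)) := fun v =>
    Finset.sum_pos (fun r _ => exp_pos _) Finset.univ_nonempty
  have hnum := exp_score_le_exp_half_mul hε hΔ (abs_le.mp (h q)).2
  have hden : ∑ r : Q, exp (ε * u' r / (2 * Δ)) ≤
      exp (ε / 2) * ∑ r : Q, exp (ε * u r / (2 * Δ)) := by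
    rw [Finset.mul_sum]
    refine Finset.sum_le_sum fun r _ => exp_score_le_exp_half_mul hε hΔ ?_
    linarith [(abs_le.mp (h r)).1]
  rw [← mul_div_assoc, div_le_div_iff₀ (hpos u) (hpos u')]
  calc _ ≤ (exp (ε / 2) * exp (ε * u' q / (2 * Δ))) *
        (exp (ε / 2) * ∑ r : Q, exp (ε * u r / (2 * Δ))) :=
        mul_le_mul hnum hden (hpos u').le (by positivity)
    _ = _ := by
        rw [show exp ε = exp (ε / 2) * exp (ε / 2) by rw [← exp_add, add_halves]]
        ring
end

section
/- Let Q be a nonempty finite set, ε > 0, Δ > 0, and u : Q → ℝ. Let p be the probability mass function on Q with p(q) proportional to exp(ε·u(q)/(2Δ)), and let u_opt = max_{q∈Q} u(q). Then for every t ≥ 0, the probability under p of the set {q ∈ Q : u_opt − u(q) ≥ (2Δ/ε)(log|Q| + t)} is at most e^{−t}. -/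
open Real
open scoped Classical

/-- Suboptimality tail bound for the exponential mechanism over a finite range:
the probability that the score gap exceeds `(2Δ/ε)(log |Q| + t)` is at most `e^{-t}`. -/
theorem exponential_mechanism_tail_bound {Q : Type*} [Fintype Q] [Nonempty Q]
    (ε Δ : ℝ) (hε : 0 < ε) (hΔ : 0 < Δ) (u : Q → ℝ) (t : ℝ) (ht : 0 ≤ t) :
    (∑ q ∈ Finset.univ.filter (fun q : Q =>
        (2 * Δ / ε) * (Real.log (Fintype.card Q) + t) ≤
          (Finset.univ.sup' Finset.univ_nonempty u) - u q),
        exp (ε * u q / (2 * Δ)) / ∑ r : Q, exp (ε * u r / (2 * Δ))) ≤ exp (-t) := by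
  obtain ⟨m, -, hm⟩ := Finset.exists_mem_eq_sup' Finset.univ_nonempty u
  have hcard : (0 : ℝ) < Fintype.card Q := by exact_mod_cast Fintype.card_pos
  have hterm : ∀ q ∈ Finset.univ.filter (fun q : Q =>
      (2 * Δ / ε) * (Real.log (Fintype.card Q) + t) ≤
        (Finset.univ.sup' Finset.univ_nonempty u) - u q),
      exp (ε * u q / (2 * Δ)) / ∑ r : Q, exp (ε * u r / (2 * Δ)) ≤
        exp (-t) / Fintype.card Q := by
    intro q hq
    rw [Finset.mem_filter, hm] at hq
    have hgap : Real.log (Fintype.card Q) + t ≤ ε * u m / (2 * Δ) - ε * u q / (2 * Δ) := by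
      calc Real.log (Fintype.card Q) + t
          = ε / (2 * Δ) * ((2 * Δ / ε) * (Real.log (Fintype.card Q) + t)) := by
            field_simp
        _ ≤ ε / (2 * Δ) * (u m - u q) := by
            gcongr
            exact hq.2
        _ = ε * u m / (2 * Δ) - ε * u q / (2 * Δ) := by ring
    have hsum : exp (ε * u m / (2 * Δ)) ≤ ∑ r : Q, exp (ε * u r / (2 * Δ)) :=
      Finset.single_le_sum (f := fun r => exp (ε * u r / (2 * Δ)))
        (fun r _ => (exp_pos _).le) (Finset.mem_univ m)
    calc exp (ε * u q / (2 * Δ)) / ∑ r : Q, exp (ε * u r / (2 * Δ))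
        ≤ exp (ε * u q / (2 * Δ)) / exp (ε * u m / (2 * Δ)) := by gcongr
      _ = exp (ε * u q / (2 * Δ) - ε * u m / (2 * Δ)) := (exp_sub _ _).symm
      _ ≤ exp (-t - Real.log (Fintype.card Q)) := exp_le_exp.2 (by linarith)
      _ = exp (-t) / Fintype.card Q := by rw [exp_sub, exp_log hcard]
  calc _ ≤ _ := Finset.sum_le_card_nsmul _ _ _ hterm
    _ ≤ Fintype.card Q * (exp (-t) / Fintype.card Q) := by
        rw [nsmul_eq_mul]
        gcongr
        exact Finset.card_le_univ _
    _ = exp (-t) := mul_div_cancel₀ _ hcard.ne'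
end

section
/- Let Q be a nonempty finite set, ε > 0, Δ > 0, and u : Q → ℝ. Let p be the probability mass function on Q with p(q) proportional to exp(ε·u(q)/(2Δ)), and let u_opt = max_{q∈Q} u(q). Then the expected suboptimality satisfies Σ_{q∈Q} p(q)·(u_opt − u(q)) ≤ 2Δ(1 + log|Q|)/ε. -/
open Real

/-- If some score `v r` dominates the scaled optimum `m`, the mean gap `m - v q` under the
Gibbs weights `exp (v q)` is at most `1 + log |Q|`, stated with the normalizer cleared. -/
theorem sum_exp_mul_gap_le {Q : Type*} [Fintype Q] [Nonempty Q]
    (v : Q → ℝ) (m : ℝ) (r : Q) (hr : m ≤ v r) :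
    ∑ q, exp (v q) * (m - v q) ≤ (1 + log (Fintype.card Q)) * ∑ q, exp (v q) := by
  have hn : (0 : ℝ) < Fintype.card Q := by exact_mod_cast Fintype.card_pos
  have hpt (q : Q) : exp (v q) * (m - v q) ≤
      log (Fintype.card Q) * exp (v q) + exp m / Fintype.card Q := by
    have h1 : m - v q - log (Fintype.card Q) ≤ exp (m - v q - log (Fintype.card Q)) := by
      linarith [add_one_le_exp (m - v q - log (Fintype.card Q))]
    have h2 : exp (v q) * exp (m - v q - log (Fintype.card Q)) = exp m / Fintype.card Q := by
      rw [← exp_add, show v q + (m - v q - log (Fintype.card Q)) = m - log (Fintype.card Q) by ring,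
        exp_sub, exp_log hn]
    linarith [mul_le_mul_of_nonneg_left h1 (exp_pos (v q)).le]
  have hm : exp m ≤ ∑ q, exp (v q) :=
    (exp_le_exp.2 hr).trans
      (Finset.single_le_sum (f := fun q => exp (v q)) (fun q _ => (exp_pos _).le)
        (Finset.mem_univ r))
  calc ∑ q, exp (v q) * (m - v q)
      ≤ ∑ q, (log (Fintype.card Q) * exp (v q) + exp m / Fintype.card Q) :=
        Finset.sum_le_sum fun q _ => hpt q
    _ = log (Fintype.card Q) * ∑ q, exp (v q) + exp m := by
        rw [Finset.sum_add_distrib, ← Finset.mul_sum, Finset.sum_const, Finset.card_univ,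
          nsmul_eq_mul, mul_div_cancel₀ _ hn.ne']
    _ ≤ (1 + log (Fintype.card Q)) * ∑ q, exp (v q) := by linarith

/-- Expected suboptimality of the exponential mechanism over a finite range:
the expected gap between the optimal score and the score of the output is at
most `2Δ(1 + log |Q|)/ε`. -/
theorem exponential_mechanism_expected_subopt {Q : Type*} [Fintype Q] [Nonempty Q]
    (ε Δ : ℝ) (hε : 0 < ε) (hΔ : 0 < Δ) (u : Q → ℝ) :
    (∑ q : Q, (exp (ε * u q / (2 * Δ)) / ∑ r : Q, exp (ε * u r / (2 * Δ))) *
        ((Finset.univ.sup' Finset.univ_nonempty u) - u q)) ≤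
      2 * Δ * (1 + Real.log (Fintype.card Q)) / ε := by
  obtain ⟨r, -, hr⟩ := Finset.exists_mem_eq_sup' Finset.univ_nonempty u
  rw [hr]
  have h := sum_exp_mul_gap_le (fun q => ε * u q / (2 * Δ)) (ε * u r / (2 * Δ)) r le_rfl
  have hW : 0 < ∑ q, exp (ε * u q / (2 * Δ)) :=
    Finset.sum_pos (fun q _ => exp_pos _) Finset.univ_nonempty
  set W := ∑ q, exp (ε * u q / (2 * Δ))
  have heq : ∑ q, exp (ε * u q / (2 * Δ)) / W * (u r - u q) =
      2 * Δ / (ε * W) *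
        ∑ q, exp (ε * u q / (2 * Δ)) * (ε * u r / (2 * Δ) - ε * u q / (2 * Δ)) := by
    rw [Finset.mul_sum]
    refine Finset.sum_congr rfl fun q _ => ?_
    generalize exp (ε * u q / (2 * Δ)) = w
    field_simp
  rw [heq]
  calc _ ≤ 2 * Δ / (ε * W) * ((1 + log (Fintype.card Q)) * W) :=
        mul_le_mul_of_nonneg_left h (by positivity)
    _ = _ := by field_simp
end

section
/- Let P ⊆ ℝ^d be a measurable set of finite positive Lebesgue measure, let f : ℝ^d → ℝ be measurable and bounded below on P with f_opt = inf_{x∈P} f(x), let ε > 0 and b_max > 0, and suppose ∫_P exp(−ε·f(x)/(2b_max)) dx > 0. Let μ be the probability measure on P with density proportional to exp(−ε·f(x)/(2b_max)). Then ∫ (f(x) − f_opt) dμ(x) ≤ C(0,ε) · 2b_max/ε, where C(0,ε) = exp(−ε·f_opt/(2b_max)) · vol(P) / ∫_P exp(−ε·f(x)/(2b_max)) dx and vol denotes Lebesgue measure. -/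
open MeasureTheory Real
open scoped ENNReal

/-- With `a = ε / (2 b)`, the elementary bound `(y - m) e^{-a y} ≤ e^{-a m} / a`. -/
lemma sub_mul_exp_neg_le {ε b : ℝ} (hε : 0 < ε) (hb : 0 < b) (y m : ℝ) :
    exp (-(ε * y) / (2 * b)) * (y - m) ≤ exp (-(ε * m) / (2 * b)) * (2 * b / ε) := by
  set u := ε * (y - m) / (2 * b) with hu
  have hsplit : exp (-(ε * y) / (2 * b)) = exp (-(ε * m) / (2 * b)) * exp (-u) := by
    rw [← exp_add, hu]
    congr 1
    ring
  have hym : y - m = u * (2 * b / ε) := by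
    rw [hu]
    field_simp
  have hle : exp (-u) * u ≤ 1 := by
    calc exp (-u) * u ≤ exp (-u) * exp u := by
          gcongr
          linarith [add_one_le_exp u]
      _ = 1 := by rw [← exp_add, neg_add_cancel, exp_zero]
  calc exp (-(ε * y) / (2 * b)) * (y - m)
      = exp (-(ε * m) / (2 * b)) * ((exp (-u) * u) * (2 * b / ε)) := by
        rw [hsplit, hym]
        ring
    _ ≤ exp (-(ε * m) / (2 * b)) * (1 * (2 * b / ε)) := by gcongr
    _ = exp (-(ε * m) / (2 * b)) * (2 * b / ε) := by rw [one_mul]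

/-- Expected suboptimality of the exponential mechanism on a feasible region `P`:
`E[f(M_E(D)) - f_opt] ≤ C(0, ε) · 2 b_max / ε`. -/
theorem exponential_mechanism_continuous_expected_subopt {d : ℕ}
    (P : Set (EuclideanSpace ℝ (Fin d))) (hP : MeasurableSet P)
    (f : EuclideanSpace ℝ (Fin d) → ℝ) (hf : Measurable f)
    (ε bmax : ℝ) (hε : 0 < ε) (hb : 0 < bmax)
    (hvol0 : 0 < volume P) (hvoltop : volume P < ⊤)
    (hbdd : BddBelow (f '' P))
    (fopt : ℝ) (hfopt : fopt = sInf (f '' P))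
    (Zr : ℝ) (hZr : Zr = ∫ x in P, exp (-(ε * f x) / (2 * bmax)))
    (hZ0 : 0 < Zr)
    (μ : Measure (EuclideanSpace ℝ (Fin d)))
    (hμ : μ = (ENNReal.ofReal Zr)⁻¹ • ((volume.restrict P).withDensity fun x =>
      ENNReal.ofReal (exp (-(ε * f x) / (2 * bmax))))) :
    ∫ x, (f x - fopt) ∂μ ≤
      exp (-(ε * fopt) / (2 * bmax)) * (volume P).toReal / Zr * (2 * bmax / ε) := by
  have hbound : ∫ x in P, exp (-(ε * f x) / (2 * bmax)) * (f x - fopt) ≤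
      (volume P).toReal * (exp (-(ε * fopt) / (2 * bmax)) * (2 * bmax / ε)) := by
    have hfin : volume P ≠ ⊤ := hvoltop.ne
    have hmono := integral_mono_of_nonneg (μ := volume.restrict P)
      (f := fun x => exp (-(ε * f x) / (2 * bmax)) * (f x - fopt))
      (g := fun _ => exp (-(ε * fopt) / (2 * bmax)) * (2 * bmax / ε))
      ((ae_restrict_iff' hP).2 <| ae_of_all _ fun x hx => by
        have hle : fopt ≤ f x := hfopt ▸ csInf_le hbdd (Set.mem_image_of_mem f hx)
        exact mul_nonneg (exp_pos _).le (sub_nonneg.2 hle))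
      (integrableOn_const hfin)
      (ae_of_all _ fun x => sub_mul_exp_neg_le hε hb (f x) fopt)
    simpa only [setIntegral_const, smul_eq_mul, Measure.real] using hmono
  have hμint : ∫ x, (f x - fopt) ∂μ =
      Zr⁻¹ * ∫ x in P, exp (-(ε * f x) / (2 * bmax)) * (f x - fopt) := by
    rw [hμ, integral_smul_measure, integral_withDensity_eq_integral_toReal_smul (by fun_prop)
      (ae_of_all _ fun _ => ENNReal.ofReal_lt_top), ENNReal.toReal_inv,
      ENNReal.toReal_ofReal hZ0.le, smul_eq_mul]
    simp only [ENNReal.toReal_ofReal (exp_pos _).le, smul_eq_mul]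
  calc ∫ x, (f x - fopt) ∂μ
      ≤ Zr⁻¹ * ((volume P).toReal * (exp (-(ε * fopt) / (2 * bmax)) * (2 * bmax / ε))) := by
        rw [hμint]
        gcongr
    _ = exp (-(ε * fopt) / (2 * bmax)) * (volume P).toReal / Zr * (2 * bmax / ε) := by
        ring
end

section
/- Let μ₁, μ₁' be probability measures on a measurable space Ω₁ and μ₂, μ₂' be probability measures on a measurable space Ω₂, and let ε₁, ε₂ > 0. Suppose μ₁(R) ≤ e^{ε₁}·μ₁'(R) for every measurable R ⊆ Ω₁ and μ₂(S) ≤ e^{ε₂}·μ₂'(S) for every measurable S ⊆ Ω₂. Then the product measures satisfy (μ₁ × μ₂)(T) ≤ e^{ε₁+ε₂}·(μ₁' × μ₂')(T) for every measurable T ⊆ Ω₁ × Ω₂. -/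
open MeasureTheory Real

/-- Sequential composition of differential privacy for independent mechanisms: if
`μ₁ ≤ e^{ε₁} μ₁'` and `μ₂ ≤ e^{ε₂} μ₂'` setwise, then the product measures satisfy
`(μ₁ × μ₂) T ≤ e^{ε₁ + ε₂} (μ₁' × μ₂') T` for every measurable `T`. -/
theorem dp_sequential_composition {Ω₁ Ω₂ : Type*} [MeasurableSpace Ω₁] [MeasurableSpace Ω₂]
    (μ₁ μ₁' : Measure Ω₁) (μ₂ μ₂' : Measure Ω₂)
    [IsProbabilityMeasure μ₁] [IsProbabilityMeasure μ₁']
    [IsProbabilityMeasure μ₂] [IsProbabilityMeasure μ₂']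
    (ε₁ ε₂ : ℝ) (hε₁ : 0 < ε₁) (hε₂ : 0 < ε₂)
    (h₁ : ∀ R : Set Ω₁, MeasurableSet R → μ₁ R ≤ ENNReal.ofReal (exp ε₁) * μ₁' R)
    (h₂ : ∀ S : Set Ω₂, MeasurableSet S → μ₂ S ≤ ENNReal.ofReal (exp ε₂) * μ₂' S) :
    ∀ T : Set (Ω₁ × Ω₂), MeasurableSet T →
      (μ₁.prod μ₂) T ≤ ENNReal.ofReal (exp (ε₁ + ε₂)) * (μ₁'.prod μ₂') T := by
  intro T hT
  have hle₁ : μ₁ ≤ ENNReal.ofReal (exp ε₁) • μ₁' := Measure.le_iff.2 h₁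
  calc (μ₁.prod μ₂) T = ∫⁻ x, μ₂ (Prod.mk x ⁻¹' T) ∂μ₁ := Measure.prod_apply hT
    _ ≤ ∫⁻ x, ENNReal.ofReal (exp ε₂) * μ₂' (Prod.mk x ⁻¹' T)
          ∂(ENNReal.ofReal (exp ε₁) • μ₁') :=
        lintegral_mono' hle₁ fun x => h₂ _ (measurable_prodMk_left hT)
    _ = ENNReal.ofReal (exp (ε₁ + ε₂)) * (μ₁'.prod μ₂') T := by
        rw [lintegral_smul_measure, lintegral_const_mul _ (measurable_measure_prodMk_left hT),
          ← Measure.prod_apply hT, smul_eq_mul, ← mul_assoc, exp_add,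
          ENNReal.ofReal_mul (exp_pos ε₁).le]
end
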